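/- Let (Xⁿ, ω) be Kähler–Einstein with Ric_ω = −(n+1)ω and suppose φ : X → ℝ satisfies i∂∂̄φ = (n+1)ω and ‖∂φ‖_ω ≡ n+1. Then the vector field V = i·e^{φ/(n+1)}·grad(φ), where grad(φ) = g^{β̄α}φ_β̄ ∂/∂zᵅ, is holomorphic, i.e., ∇''V = 0. -/

import Mathlib

noncomputable section

open Complex BigOperators
open scoped ComplexOrder

variable {n : ℕ}

/-- Wirtinger derivative `∂f/∂zᵅ` of `f : ℂⁿ → ℂ` at `x`. -/
def wdz (α : Fin n) (f : (Fin n → ℂ) → ℂ) (x : Fin n → ℂ) : ℂ :=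
  (fderiv ℝ f x (Pi.single α 1) - Complex.I * fderiv ℝ f x (Pi.single α Complex.I)) / 2

/-- Wirtinger derivative `∂f/∂z̄ᵅ` of `f : ℂⁿ → ℂ` at `x`. -/
def wdzbar (α : Fin n) (f : (Fin n → ℂ) → ℂ) (x : Fin n → ℂ) : ℂ :=
  (fderiv ℝ f x (Pi.single α 1) + Complex.I * fderiv ℝ f x (Pi.single α Complex.I)) / 2

-- A Hermitian metric is given by its matrix of components `g x α β = g_{α β̄}(x)`.
variable (g : (Fin n → ℂ) → Matrix (Fin n) (Fin n) ℂ)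

/-- Christoffel symbols `Γ^β_{αλ} = g^{δ̄β} ∂_α g_{λδ̄}` of the Kähler (Chern) connection;
`(g x)⁻¹ δ β` represents `g^{δ̄β}`. -/
def christoffel (β α lam : Fin n) (x : Fin n → ℂ) : ℂ :=
  ∑ δ, wdz α (fun y => g y lam δ) x * (g x)⁻¹ δ β

/-- Curvature tensor `R^β_{αλμ̄} = −∂_μ̄ Γ^β_{αλ}`, with the convention
`(∇_λ∇_μ̄ − ∇_μ̄∇_λ)∂_α = R^β_{αλμ̄} ∂_β`. -/
def curvature (β α lam μ : Fin n) (x : Fin n → ℂ) : ℂ :=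
  - wdzbar μ (fun y => christoffel g β α lam y) x

variable (φ : (Fin n → ℂ) → ℝ)

/-- `φ_α = ∂φ/∂zᵅ`. -/
def dphi (α : Fin n) (x : Fin n → ℂ) : ℂ := wdz α (fun y => (φ y : ℂ)) x

/-- `φ_ᾱ = ∂φ/∂z̄ᵅ`. -/
def dphibar (α : Fin n) (x : Fin n → ℂ) : ℂ := wdzbar α (fun y => (φ y : ℂ)) x

/-- The covariant `(2,0)`-Hessian `φ_{α;β} = ∂_β φ_α − Γ^γ_{αβ} φ_γ`. -/
def hess20 (α β : Fin n) (x : Fin n → ℂ) : ℂ :=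
  wdz β (fun y => dphi φ α y) x - ∑ γ, christoffel g γ α β x * dphi φ γ x

/-- The squared length `u = ‖∂φ‖²_ω = φ_α φ_β̄ g^{β̄α}` of the `(1,0)`-differential of `φ`. -/
def gradNormSq (x : Fin n → ℂ) : ℂ :=
  ∑ α, ∑ β, dphi φ α x * (starRingEnd ℂ) (dphi φ β x) * (g x)⁻¹ β α

/-- The `(1,0)`-gradient `grad(φ)^α = g^{β̄α} φ_β̄`. -/
def gradUp (α : Fin n) (x : Fin n → ℂ) : ℂ :=
  ∑ β, (g x)⁻¹ β α * (starRingEnd ℂ) (dphi φ β x)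

/-- The Laplace–Beltrami operator `Δ_ω u = g^{β̄α} ∂_α ∂_β̄ u` on functions. -/
def lapBeltrami (u : (Fin n → ℂ) → ℂ) (x : Fin n → ℂ) : ℂ :=
  ∑ α, ∑ β, (g x)⁻¹ β α * wdz α (fun y => wdzbar β u y) x

/-- `‖∇'²φ‖²_ω = φ_{α;β} φ^{α;β} = φ_{α;β} conj(φ_{γ;δ}) g^{γ̄α} g^{δ̄β}`. -/
def hessNormSq (x : Fin n → ℂ) : ℂ :=
  ∑ α, ∑ β, ∑ γ, ∑ δ,
    hess20 g φ α β x * (starRingEnd ℂ) (hess20 g φ γ δ x) * (g x)⁻¹ γ α * (g x)⁻¹ δ β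


section helpers

/-- common form of the Wirtinger derivatives -/
def wd (c : ℂ) (α : Fin n) (f : (Fin n → ℂ) → ℂ) (x : Fin n → ℂ) : ℂ :=
  (fderiv ℝ f x (Pi.single α 1) + c * fderiv ℝ f x (Pi.single α Complex.I)) / 2

theorem wdz_eq (α : Fin n) (f : (Fin n → ℂ) → ℂ) : wdz α f = wd (-Complex.I) α f := by
  funext x; simp only [wdz, wd]; ring

theorem wdzbar_eq (α : Fin n) (f : (Fin n → ℂ) → ℂ) : wdzbar α f = wd (Complex.I) α f := by
  funext x; simp only [wdzbar, wd]

/-- smooth functions on U -/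
def Sm (U : Set (Fin n → ℂ)) (f : (Fin n → ℂ) → ℂ) : Prop := ContDiffOn ℝ (⊤ : ℕ∞) f U

variable {U : Set (Fin n → ℂ)} {f h : (Fin n → ℂ) → ℂ} {x : Fin n → ℂ}

theorem Sm.diffAt (hU : IsOpen U) (hf : Sm U f) (hx : x ∈ U) : DifferentiableAt ℝ f x :=
  (ContDiffOn.differentiableOn hf (by simp)).differentiableAt (hU.mem_nhds hx)

theorem Sm.mul (hf : Sm U f) (hh : Sm U h) : Sm U (fun y => f y * h y) := ContDiffOn.mul hf hh
theorem Sm.add (hf : Sm U f) (hh : Sm U h) : Sm U (fun y => f y + h y) := ContDiffOn.add hf hh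
theorem Sm.sub (hf : Sm U f) (hh : Sm U h) : Sm U (fun y => f y - h y) := ContDiffOn.sub hf hh
theorem Sm.const (c : ℂ) : Sm U (fun _ => c) := contDiffOn_const
theorem Sm.sum {ι : Type*} {s : Finset ι} {F : ι → (Fin n → ℂ) → ℂ} (hF : ∀ i, Sm U (F i)) :
    Sm U (fun y => ∑ i ∈ s, F i y) := ContDiffOn.sum (fun i _ => hF i)
theorem Sm.prod {ι : Type*} {s : Finset ι} {F : ι → (Fin n → ℂ) → ℂ} (hF : ∀ i, Sm U (F i)) :
    Sm U (fun y => ∏ i ∈ s, F i y) := contDiffOn_prod (fun i _ => hF i)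
theorem Sm.conj (hf : Sm U f) : Sm U (fun y => (starRingEnd ℂ) (f y)) :=
  (Complex.conjCLE.contDiff (n := (⊤ : ℕ∞))).comp_contDiffOn hf

theorem Sm.wd (hU : IsOpen U) (hf : Sm U f) (c : ℂ) (α : Fin n) : Sm U (wd c α f) := by
  have h1 : ContDiffOn ℝ (⊤ : ℕ∞) (fderiv ℝ f) U := hf.fderiv_of_isOpen hU (by simp)
  have h2 : ∀ v : Fin n → ℂ, Sm U (fun y => fderiv ℝ f y v) := fun v =>
    h1.clm_apply contDiffOn_const
  unfold _root_.wd
  have := (((h2 (Pi.single α 1)).add ((Sm.const c).mul (h2 (Pi.single α Complex.I)))).mul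
    (Sm.const (2⁻¹)))
  simpa only [div_eq_mul_inv] using this

theorem Sm.wdz (hU : IsOpen U) (hf : Sm U f) (α : Fin n) : Sm U (fun y => wdz α f y) := by
  rw [wdz_eq]; exact hf.wd hU _ _
theorem Sm.wdzbar (hU : IsOpen U) (hf : Sm U f) (α : Fin n) : Sm U (fun y => wdzbar α f y) := by
  rw [wdzbar_eq]; exact hf.wd hU _ _

theorem wd_mul (hU : IsOpen U) (hx : x ∈ U) (hf : Sm U f) (hh : Sm U h) (c : ℂ) (α : Fin n) :
    wd c α (fun y => f y * h y) x = wd c α f x * h x + f x * wd c α h x := by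
  have := fderiv_fun_mul (hf.diffAt hU hx) (hh.diffAt hU hx)
  simp only [wd, this]
  simp
  ring

theorem wd_add (hU : IsOpen U) (hx : x ∈ U) (hf : Sm U f) (hh : Sm U h) (c : ℂ) (α : Fin n) :
    wd c α (fun y => f y + h y) x = wd c α f x + wd c α h x := by
  have := fderiv_fun_add (hf.diffAt hU hx) (hh.diffAt hU hx)
  simp only [wd, this]
  simp
  ring

theorem wd_sub (hU : IsOpen U) (hx : x ∈ U) (hf : Sm U f) (hh : Sm U h) (c : ℂ) (α : Fin n) :
    wd c α (fun y => f y - h y) x = wd c α f x - wd c α h x := by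
  have := fderiv_fun_sub (hf.diffAt hU hx) (hh.diffAt hU hx)
  simp only [wd, this]
  simp
  ring

theorem wd_const (a c : ℂ) (α : Fin n) : wd c α (fun _ => a) x = 0 := by
  simp [wd]

theorem wd_sum (hU : IsOpen U) (hx : x ∈ U) {ι : Type*} {s : Finset ι}
    {F : ι → (Fin n → ℂ) → ℂ} (hF : ∀ i, Sm U (F i)) (c : ℂ) (α : Fin n) :
    wd c α (fun y => ∑ i ∈ s, F i y) x = ∑ i ∈ s, wd c α (F i) x := by
  have := fderiv_fun_sum (u := s) (fun i _ => (hF i).diffAt hU hx)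
  simp only [wd, this]
  simp [Finset.sum_add_distrib, Finset.mul_sum, Finset.sum_div, add_div]

theorem wd_congr (hU : IsOpen U) (hx : x ∈ U) (he : ∀ y ∈ U, f y = h y) (c : ℂ) (α : Fin n) :
    wd c α f x = wd c α h x := by
  have : f =ᶠ[nhds x] h := Filter.eventuallyEq_of_mem (hU.mem_nhds hx) he
  simp only [wd, this.fderiv_eq]

theorem wd_conj (hU : IsOpen U) (hx : x ∈ U) (hf : Sm U f) (c : ℂ) (α : Fin n) :
    wd c α (fun y => (starRingEnd ℂ) (f y)) x
      = (starRingEnd ℂ) (wd ((starRingEnd ℂ) c) α f x) := by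
  have h1 : HasFDerivAt (fun y => (starRingEnd ℂ) (f y))
      ((Complex.conjCLE : ℂ →L[ℝ] ℂ).comp (fderiv ℝ f x)) x :=
    (Complex.conjCLE : ℂ →L[ℝ] ℂ).hasFDerivAt.comp x (hf.diffAt hU hx).hasFDerivAt
  simp only [wd, h1.fderiv]
  simp [map_ofNat]

theorem wd_comm (hU : IsOpen U) (hx : x ∈ U) (hf : Sm U f) (c d : ℂ) (α β : Fin n) :
    wd c α (fun y => wd d β f y) x = wd d β (fun y => wd c α f y) x := by
  have h1 : ContDiffOn ℝ (⊤ : ℕ∞) (fderiv ℝ f) U := hf.fderiv_of_isOpen hU (by simp)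
  have h1d : DifferentiableAt ℝ (fderiv ℝ f) x :=
    (h1.differentiableOn (by simp)).differentiableAt (hU.mem_nhds hx)
  have h2 : ∀ v : Fin n → ℂ, Sm U (fun y => fderiv ℝ f y v) := fun v =>
    h1.clm_apply contDiffOn_const
  have hs : IsSymmSndFDerivAt ℝ f x :=
    (hf.contDiffAt (hU.mem_nhds hx)).isSymmSndFDerivAt 
      (by simp; exact WithTop.coe_le_coe.2 (le_top : (2 : ℕ∞) ≤ ⊤))
  have h3 : ∀ v w : Fin n → ℂ,
      fderiv ℝ (fun y => fderiv ℝ f y v) x w = fderiv ℝ (fderiv ℝ f) x w v := by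
    intro v w
    have := (h1d.hasFDerivAt.clm_apply (hasFDerivAt_const v x)).fderiv
    rw [this]; simp
  have h4 : ∀ (c d : ℂ) (α β : Fin n), wd c α (fun y => wd d β f y) x =
      (wd c α (fun y => fderiv ℝ f y (Pi.single β 1)) x
        + d * wd c α (fun y => fderiv ℝ f y (Pi.single β Complex.I)) x) * 2⁻¹ := by
    intro c d α β
    have e : (fun y => wd d β f y) = fun y => (fderiv ℝ f y (Pi.single β 1)
      + d * fderiv ℝ f y (Pi.single β Complex.I)) * 2⁻¹ := by
      funext y; simp only [wd, div_eq_mul_inv]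
    rw [e, wd_mul hU hx ((h2 _).add ((Sm.const d).mul (h2 _))) (Sm.const _),
      wd_add hU hx (h2 _) ((Sm.const d).mul (h2 _)), wd_mul hU hx (Sm.const d) (h2 _),
      wd_const, wd_const]
    ring
  rw [h4, h4]
  simp only [wd, h3]
  rw [hs.eq (Pi.single α 1) (Pi.single β 1), hs.eq (Pi.single α Complex.I) (Pi.single β 1),
    hs.eq (Pi.single α 1) (Pi.single β Complex.I),
    hs.eq (Pi.single α Complex.I) (Pi.single β Complex.I)]
  ring

theorem wd_cexp (hU : IsOpen U) (hx : x ∈ U) (hf : Sm U f) (c : ℂ) (α : Fin n) :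
    wd c α (fun y => Complex.exp (f y)) x = Complex.exp (f x) * wd c α f x := by
  have := (hf.diffAt hU hx).hasFDerivAt.cexp.fderiv
  simp only [wd, this]
  simp
  ring

theorem Sm.cexp (hf : Sm U f) : Sm U (fun y => Complex.exp (f y)) := ContDiffOn.cexp hf

theorem Sm.det {m : ℕ} {M : (Fin n → ℂ) → Matrix (Fin m) (Fin m) ℂ}
    (hM : ∀ i j, Sm U (fun y => M y i j)) : Sm U (fun y => (M y).det) := by
  simp only [Matrix.det_apply']
  exact Sm.sum fun σ => (Sm.const _).mul (Sm.prod fun i => hM _ _)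

theorem Sm.inv {m : ℕ} {M : (Fin n → ℂ) → Matrix (Fin m) (Fin m) ℂ}
    (hM : ∀ i j, Sm U (fun y => M y i j)) (hd : ∀ y ∈ U, (M y).det ≠ 0) (i j : Fin m) :
    Sm U (fun y => (M y)⁻¹ i j) := by
  simp only [Matrix.inv_def, Ring.inverse_eq_inv', Matrix.smul_apply, smul_eq_mul,
    Matrix.adjugate_apply]
  refine Sm.mul (ContDiffOn.inv (Sm.det hM) hd) (Sm.det ?_)
  intro k l
  by_cases hk : k = j
  · subst hk; simp only [Matrix.updateRow_self]; exact Sm.const _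
  · simp only [Matrix.updateRow_ne hk]; exact hM _ _

open Matrix MatrixOrder in
theorem matrix_key {m : ℕ} {A B : Matrix (Fin m) (Fin m) ℂ} (hA : A.PosDef) (hB : B.PosDef)
    (Q : Matrix (Fin m) (Fin m) ℂ) (h : (Qᴴ * A * Q * B).trace = 0) : Q = 0 := by
  obtain ⟨X, hX, rfl⟩ := CStarAlgebra.isStrictlyPositive_iff_eq_star_mul_self.mp
        hA.isStrictlyPositive
  obtain ⟨Y, hY, rfl⟩ := CStarAlgebra.isStrictlyPositive_iff_eq_star_mul_self.mp
        hB.isStrictlyPositive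
  have h1 : ((X * Q * Yᴴ)ᴴ * (X * Q * Yᴴ)).trace = 0 := by
    rw [← h, ← mul_assoc _ (star Y) Y, trace_mul_comm _ Y]
    simp only [conjTranspose_mul, conjTranspose_conjTranspose, mul_assoc, star_eq_conjTranspose]
  rw [trace_conjTranspose_mul_self_eq_zero_iff] at h1
  have hY' : IsUnit Yᴴ := hY.star
  rw [hY'.mul_left_eq_zero, hX.mul_right_eq_zero] at h1
  exact h1

theorem wdz_leib (hU : IsOpen U) (hx : x ∈ U) {F K : Fin n → (Fin n → ℂ) → ℂ}
    (hF : ∀ i, Sm U (F i)) (hK : ∀ i, Sm U (K i)) (he : ∀ y ∈ U, ∑ i, F i y * K i y = h y)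
    (α : Fin n) :
    ∑ i, wdz α (F i) x * K i x + ∑ i, F i x * wdz α (K i) x = wdz α h x := by
  simp only [wdz_eq]
  rw [← wd_congr hU hx he, wd_sum hU hx (fun i => (hF i).mul (hK i)), ← Finset.sum_add_distrib]
  exact Finset.sum_congr rfl fun i _ => (wd_mul hU hx (hF i) (hK i) _ _).symm

theorem wdzbar_leib (hU : IsOpen U) (hx : x ∈ U) {F K : Fin n → (Fin n → ℂ) → ℂ}
    (hF : ∀ i, Sm U (F i)) (hK : ∀ i, Sm U (K i)) (he : ∀ y ∈ U, ∑ i, F i y * K i y = h y)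
    (α : Fin n) :
    ∑ i, wdzbar α (F i) x * K i x + ∑ i, F i x * wdzbar α (K i) x = wdzbar α h x := by
  simp only [wdzbar_eq]
  rw [← wd_congr hU hx he, wd_sum hU hx (fun i => (hF i).mul (hK i)), ← Finset.sum_add_distrib]
  exact Finset.sum_congr rfl fun i _ => (wd_mul hU hx (hF i) (hK i) _ _).symm

theorem wdz_conj (hU : IsOpen U) (hx : x ∈ U) (hf : Sm U f) (α : Fin n) :
    wdz α (fun y => (starRingEnd ℂ) (f y)) x = (starRingEnd ℂ) (wdzbar α f x) := by
  rw [wdz_eq, wdzbar_eq, wd_conj hU hx hf]; simp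

theorem wdzbar_conj (hU : IsOpen U) (hx : x ∈ U) (hf : Sm U f) (α : Fin n) :
    wdzbar α (fun y => (starRingEnd ℂ) (f y)) x = (starRingEnd ℂ) (wdz α f x) := by
  rw [wdz_eq, wdzbar_eq, wd_conj hU hx hf]; simp

theorem wdz_wdzbar (hU : IsOpen U) (hx : x ∈ U) (hf : Sm U f) (α β : Fin n) :
    wdz α (fun y => wdzbar β f y) x = wdzbar β (fun y => wdz α f y) x := by
  rw [wdz_eq, wdzbar_eq, wdz_eq, wdzbar_eq]; exact wd_comm hU hx hf _ _ _ _

theorem wdz_congr (hU : IsOpen U) (hx : x ∈ U) (he : ∀ y ∈ U, f y = h y) (α : Fin n) :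
    wdz α f x = wdz α h x := by
  rw [wdz_eq, wdz_eq]; exact wd_congr hU hx he _ _

theorem wdzbar_congr (hU : IsOpen U) (hx : x ∈ U) (he : ∀ y ∈ U, f y = h y) (α : Fin n) :
    wdzbar α f x = wdzbar α h x := by
  rw [wdzbar_eq, wdzbar_eq]; exact wd_congr hU hx he _ _

theorem minv_apply {A B : Matrix (Fin n) (Fin n) ℂ} (hAB : A * B = 1) (a : Fin n → ℂ) (γ : Fin n) :
    ∑ β, (∑ δ, a δ * A δ β) * B β γ = a γ := by
  have : Matrix.vecMul (Matrix.vecMul a A) B = a := by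
    rw [Matrix.vecMul_vecMul, hAB, Matrix.vecMul_one]
  exact congrFun this γ

theorem mcancel {A B : Matrix (Fin n) (Fin n) ℂ} (hAB : A * B = 1) {a b : Fin n → ℂ}
    (hab : ∀ γ, ∑ α, a α * A α γ = ∑ α, b α * A α γ) (α : Fin n) : a α = b α := by
  rw [← minv_apply hAB a, ← minv_apply hAB b]
  simp only [hab]

open Matrix in
/-- The final linear algebra at a point. -/
theorem final_alg {g G H W : Matrix (Fin n) (Fin n) ℂ} {p v : Fin n → ℂ} {N : ℂ} (hN : N ≠ 0)
    (hNr : star N = N) (hg : g.PosDef) (hG : G.PosDef) (hgG : g * G = 1)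
    (h1 : v ᵥ* g = star p) (h2 : v ᵥ* H = -(N • p)) (h3 : (Hᵀ * W * G).trace = N ^ 2)
    (h4 : Wᵀ * g = Hᴴ) (h5 : p ᵥ* W = -(N • star p)) (h6 : p ⬝ᵥ v = N ^ 2) :
    W + N⁻¹ • vecMulVec v (star p) = 0 := by
  set Q := W + N⁻¹ • vecMulVec v (star p) with hQ
  have hv : star p ᵥ* G = v := by rw [← h1, vecMul_vecMul, hgG, vecMul_one]
  have hT : Qᵀ * g = (H + N⁻¹ • vecMulVec p p)ᴴ := by
    rw [hQ, transpose_add, transpose_smul, transpose_vecMulVec, add_mul, h4, smul_mul_assoc,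
      vecMulVec_mul, h1, conjTranspose_add, conjTranspose_smul, conjTranspose_vecMulVec]
    simp [hNr]
  have hT2 : Qᴴ * gᵀ = (H + N⁻¹ • vecMulVec p p)ᵀ := by
    have := congrArg (fun M => Mᴴᵀ) hT
    simp only [conjTranspose_mul, conjTranspose_conjTranspose, transpose_mul, hg.1.eq] at this
    rw [← this]; rfl
  refine matrix_key hg.transpose hG Q ?_
  rw [hT2]
  have e : (H + N⁻¹ • vecMulVec p p)ᵀ * Q = Hᵀ * W - vecMulVec p (star p) := by
    rw [hQ, transpose_add, transpose_smul, transpose_vecMulVec]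
    simp only [add_mul, mul_add, smul_mul_assoc, mul_smul_comm, mul_vecMulVec, vecMulVec_mul,
      vecMulVec_mulVec, mulVec_transpose, h2, h5, h6]
    ext i j
    simp [vecMulVec_apply]
    field_simp
    ring
  rw [e, sub_mul, trace_sub, h3, vecMulVec_mul, hv, trace_vecMulVec, h6, sub_self]

end helpers

/-- On a Kähler–Einstein manifold with `Ric_ω = −(n+1)ω`, if
`i∂∂̄φ = (n+1)ω` and `‖∂φ‖_ω ≡ n+1`, then the vector field
`V = i·e^{φ/(n+1)}·grad(φ)` is holomorphic, i.e. `∇''V = 0` (`V^α_{;β̄} = ∂_β̄ V^α = 0`). -/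
theorem gradient_vector_field_holomorphic
    (U : Set (Fin n → ℂ)) (hU : IsOpen U)
    (hherm : ∀ x ∈ U, (g x).IsHermitian)
    (hpos : ∀ x ∈ U, (g x).PosDef)
    (hgsmooth : ∀ α β : Fin n, ContDiffOn ℝ (⊤ : ℕ∞) (fun y => g y α β) U)
    (hkahler : ∀ x ∈ U, ∀ α β γ : Fin n,
      wdz γ (fun y => g y α β) x = wdz α (fun y => g y γ β) x)
    (hEinstein : ∀ x ∈ U, ∀ lam μ : Fin n,
      (∑ α, curvature g α α lam μ x) = -((n : ℂ) + 1) * g x lam μ)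
    (hφsmooth : ContDiffOn ℝ (⊤ : ℕ∞) (fun y => (φ y : ℂ)) U)
    (hpot : ∀ x ∈ U, ∀ α β : Fin n,
      wdzbar β (fun y => dphi φ α y) x = ((n : ℂ) + 1) * g x α β)    (hconst : ∀ x ∈ U, gradNormSq g φ x = ((n : ℂ) + 1) ^ 2) :
    ∀ x ∈ U, ∀ α β : Fin n,
      wdzbar β
        (fun y => Complex.I * Complex.exp ((φ y : ℂ) / ((n : ℂ) + 1)) * gradUp g φ α y)
        x = 0 := by
  classical
  have hN : (n : ℂ) + 1 ≠ 0 := Nat.cast_add_one_ne_zero n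
  have hNr : (starRingEnd ℂ) ((n : ℂ) + 1) = (n : ℂ) + 1 := by simp
  set N : ℂ := (n : ℂ) + 1 with hNdef
  have hdet : ∀ y ∈ U, (g y).det ≠ 0 := fun y hy => (hpos y hy).det_pos.ne'
  have hgG : ∀ y ∈ U, g y * (g y)⁻¹ = 1 := fun y hy =>
    Matrix.mul_nonsing_inv _ (isUnit_iff_ne_zero.2 (hdet y hy))
  have hGg : ∀ y ∈ U, (g y)⁻¹ * g y = 1 := fun y hy =>
    Matrix.nonsing_inv_mul _ (isUnit_iff_ne_zero.2 (hdet y hy))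
  have sg : ∀ α β, Sm U (fun y => g y α β) := hgsmooth
  have sG : ∀ α β, Sm U (fun y => (g y)⁻¹ α β) := fun α β => Sm.inv sg hdet α β
  have sφ : Sm U (fun y => (φ y : ℂ)) := hφsmooth
  have sp : ∀ α, Sm U (dphi φ α) := fun α => sφ.wdz hU α
  have sv : ∀ α, Sm U (gradUp g φ α) := fun α =>
    Sm.sum fun β => (sG β α).mul (sp β).conj
  have sΓ : ∀ μ α γ, Sm U (christoffel g μ α γ) := fun μ α γ =>
    Sm.sum fun δ => ((sg γ δ).wdz hU α).mul (sG δ μ)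
  have sH : ∀ α γ, Sm U (hess20 g φ α γ) := fun α γ =>
    ((sp α).wdz hU γ).sub (Sm.sum fun μ => (sΓ μ α γ).mul (sp μ))
  have gh : ∀ y ∈ U, ∀ α β, (starRingEnd ℂ) (g y α β) = g y β α := fun y hy α β =>
    (hherm y hy).apply β α
  have e1 : ∀ γ, ∀ y ∈ U, ∑ α, gradUp g φ α y * g y α γ = (starRingEnd ℂ) (dphi φ γ y) := by
    intro γ y hy
    have := minv_apply (hGg y hy) (fun δ => (starRingEnd ℂ) (dphi φ δ y)) γ
    simpa only [gradUp, mul_comm] using this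
  have e2 : ∀ α γ δ, ∀ y ∈ U, ∑ μ, christoffel g μ α γ y * g y μ δ
      = wdz α (fun z => g z γ δ) y := by
    intro α γ δ y hy
    exact minv_apply (hGg y hy) (fun δ => wdz α (fun z => g z γ δ) y) δ
  have Γsymm : ∀ μ α γ, ∀ y ∈ U, christoffel g μ α γ y = christoffel g μ γ α y := by
    intro μ α γ y hy
    simp only [christoffel]
    exact Finset.sum_congr rfl fun δ _ => by rw [hkahler y hy]
  have kbar : ∀ α γ δ, ∀ y ∈ U, wdzbar γ (fun z => g z α δ) y = wdzbar δ (fun z => g z α γ) y := by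
    intro α γ δ y hy
    have h : ∀ γ δ, wdzbar γ (fun z => g z α δ) y
        = (starRingEnd ℂ) (wdz γ (fun z => g z δ α) y) := by
      intro γ δ
      rw [← wdzbar_conj hU hy (sg δ α)]
      exact wdzbar_congr hU hy (fun z hz => (gh z hz δ α).symm) γ
    rw [h, h, hkahler y hy]
  have pbar : ∀ γ δ, ∀ y ∈ U, wdz γ (fun z => (starRingEnd ℂ) (dphi φ δ z)) y = N * g y γ δ := by
    intro γ δ y hy
    rw [wdz_conj hU hy (sp δ)]
    have := hpot y hy δ γ
    rw [show wdzbar γ (dphi φ δ) y = N * g y δ γ from this, map_mul, hNr, gh y hy]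
  have e3 : ∀ γ α, ∀ y ∈ U, wdz γ (gradUp g φ α) y
      = (if γ = α then N else 0) - ∑ l, gradUp g φ l y * christoffel g α γ l y := by
    intro γ α y hy
    refine mcancel (hgG y hy) (a := fun α => wdz γ (gradUp g φ α) y)
      (b := fun α => (if γ = α then N else 0) - ∑ l, gradUp g φ l y * christoffel g α γ l y) ?_ α
    intro δ
    have h := wdz_leib hU hy sv (fun i => sg i δ) (e1 δ) γ
    rw [pbar γ δ y hy] at h
    have h' : ∑ α, (∑ l, gradUp g φ l y * christoffel g α γ l y) * g y α δ
        = ∑ i, gradUp g φ i y * wdz γ (fun z => g z i δ) y := by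
      simp only [← e2 γ _ δ y hy, Finset.sum_mul, Finset.mul_sum]
      rw [Finset.sum_comm]
      simp only [mul_assoc]
    simp only [sub_mul, Finset.sum_sub_distrib, h']
    simp only [ite_mul, zero_mul, Finset.sum_ite_eq, Finset.mem_univ, if_true]
    linear_combination h
  have e0 : ∀ y ∈ U, ∑ α, dphi φ α y * gradUp g φ α y = N ^ 2 := by
    intro y hy
    rw [← hconst y hy]
    simp only [gradNormSq, gradUp, Finset.mul_sum]
    exact Finset.sum_congr rfl fun α _ => Finset.sum_congr rfl fun β _ => by ring
  have e4 : ∀ γ, ∀ y ∈ U, ∑ α, hess20 g φ α γ y * gradUp g φ α y = -N * dphi φ γ y := by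
    intro γ y hy
    have h := wdz_leib hU hy sp sv e0 γ
    rw [wdz_eq γ (fun _ => N ^ 2), wd_const] at h
    simp only [e3 γ _ y hy, mul_sub, Finset.sum_sub_distrib] at h
    simp only [mul_ite, mul_zero, Finset.sum_ite_eq, Finset.mem_univ, if_true] at h
    have h' : ∑ α, (∑ μ, christoffel g μ α γ y * dphi φ μ y) * gradUp g φ α y
        = ∑ i, dphi φ i y * ∑ l, gradUp g φ l y * christoffel g i γ l y := by
      simp only [Finset.sum_mul, Finset.mul_sum]
      rw [Finset.sum_comm]
      exact Finset.sum_congr rfl fun i _ => Finset.sum_congr rfl fun j _ => by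
        rw [Γsymm i γ j y hy]; ring
    simp only [hess20, sub_mul, Finset.sum_sub_distrib, h']
    linear_combination h
  have ehess : ∀ α γ δ, ∀ y ∈ U, wdzbar δ (hess20 g φ α γ) y
      = ∑ μ, curvature g μ α γ δ y * dphi φ μ y := by
    intro α γ δ y hy
    have h1 : wdzbar δ (hess20 g φ α γ) y = wdzbar δ (fun z => wdz γ (dphi φ α) z) y
        - wdzbar δ (fun z => ∑ μ, christoffel g μ α γ z * dphi φ μ z) y := by
      simp only [wdzbar_eq]
      exact wd_sub hU hy ((sp α).wdz hU γ) (Sm.sum fun μ => (sΓ μ α γ).mul (sp μ)) _ _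
    have h2 := wdzbar_leib hU hy (fun μ => sΓ μ α γ) sp (fun z _ => rfl) δ
    have h3 : wdzbar δ (fun z => wdz γ (dphi φ α) z) y = N * wdz γ (fun z => g z α δ) y := by
      rw [← wdz_wdzbar hU hy (sp α), wdz_congr hU hy (fun z hz => hpot z hz α δ), wdz_eq,
        wd_mul hU hy (Sm.const N) (sg α δ), wd_const, wdz_eq]
      ring
    have h4 : ∑ i, christoffel g i α γ y * wdzbar δ (dphi φ i) y
        = N * wdz γ (fun z => g z α δ) y := by
      rw [hkahler y hy α δ γ, ← e2 α γ δ y hy, Finset.mul_sum]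
      refine Finset.sum_congr rfl fun i _ => ?_
      rw [show wdzbar δ (dphi φ i) y = N * g y i δ from hpot y hy i δ]; ring
    rw [h1, h3, ← h2, h4]
    have h5 : ∀ i, wdzbar δ (christoffel g i α γ) y = - curvature g i α γ δ y := fun i => by
      simp only [curvature, neg_neg]
    simp only [h5, neg_mul, Finset.sum_neg_distrib]
    ring
  have e6 : ∀ γ δ, ∀ y ∈ U, ∑ α, (∑ μ, curvature g μ α γ δ y * dphi φ μ y) * gradUp g φ α y
      + ∑ α, hess20 g φ α γ y * wdzbar δ (gradUp g φ α) y = -N * (N * g y γ δ) := by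
    intro γ δ y hy
    have h := wdzbar_leib hU hy (fun α => sH α γ) sv (e4 γ) δ
    simp only [ehess _ γ δ y hy] at h
    rw [h, wdzbar_eq, wd_mul hU hy (Sm.const _) (sp γ), wd_const, ← wdzbar_eq,
      show wdzbar δ (dphi φ γ) y = N * g y γ δ from hpot y hy γ δ]
    ring
  have e7 : ∀ γ δ, ∀ y ∈ U, ∑ α, wdzbar δ (gradUp g φ α) y * g y α γ
      = (starRingEnd ℂ) (hess20 g φ γ δ y) := by
    intro γ δ y hy
    have h := wdzbar_leib hU hy sv (fun i => sg i γ) (e1 γ) δ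
    rw [wdzbar_conj hU hy (sp γ)] at h
    have h' : (starRingEnd ℂ) (∑ μ, christoffel g μ γ δ y * dphi φ μ y)
        = ∑ i, gradUp g φ i y * wdzbar δ (fun z => g z i γ) y := by
      have hp : ∀ μ, dphi φ μ y = ∑ α, (starRingEnd ℂ) (gradUp g φ α y) * g y μ α := by
        intro μ
        have := congrArg (starRingEnd ℂ) (e1 μ y hy)
        simp only [map_sum, map_mul, gh y hy, Complex.conj_conj] at this
        exact this.symm
      have h2 : ∑ μ, christoffel g μ γ δ y * dphi φ μ y
          = ∑ α, (starRingEnd ℂ) (gradUp g φ α y) * wdz γ (fun z => g z δ α) y := by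
        simp only [hp, ← e2 γ δ _ y hy, Finset.mul_sum]
        rw [Finset.sum_comm]
        exact Finset.sum_congr rfl fun i _ => Finset.sum_congr rfl fun j _ => by ring
      rw [h2, map_sum]
      refine Finset.sum_congr rfl fun i _ => ?_
      rw [map_mul, Complex.conj_conj, ← wdzbar_conj hU hy (sg δ i), kbar i δ γ y hy]
      rw [wdzbar_congr hU hy (fun z hz => gh z hz δ i)]
    simp only [hess20, map_sub, h']
    have h3 : wdz δ (fun z => dphi φ γ z) y = wdz δ (dphi φ γ) y := rfl
    rw [h3, ← h]; ring
  -- curvature symmetries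
  have eK : ∀ α γ δ ν, ∀ y ∈ U, ∑ μ, curvature g μ α γ δ y * g y μ ν
      = ∑ μ, christoffel g μ α γ y * wdzbar δ (fun z => g z μ ν) y
        - wdzbar δ (fun z => wdz α (fun w => g w γ ν) z) y := by
    intro α γ δ ν y hy
    have h := wdzbar_leib hU hy (fun μ => sΓ μ α γ) (fun μ => sg μ ν) (e2 α γ ν) δ
    have h5 : ∀ i, curvature g i α γ δ y = -wdzbar δ (christoffel g i α γ) y := fun i => rfl
    simp only [h5, neg_mul, Finset.sum_neg_distrib]
    rw [← h]; ring
  have Ksymm : ∀ α γ δ ν, ∀ y ∈ U, ∑ μ, curvature g μ α γ δ y * g y μ ν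
      = ∑ μ, curvature g μ γ α ν y * g y μ δ := by
    intro α γ δ ν y hy
    rw [eK α γ δ ν y hy, eK γ α ν δ y hy]
    congr 1
    · exact Finset.sum_congr rfl fun μ _ => by rw [Γsymm μ α γ y hy, kbar μ δ ν y hy]
    · rw [← wdz_wdzbar hU hy (sg γ ν), wdz_congr hU hy (fun z hz => kbar γ δ ν z hz),
        wdz_wdzbar hU hy (sg γ δ)]
      exact wdzbar_congr hU hy (fun z hz => hkahler z hz γ δ α) ν
  have eRic : ∀ μ α, ∀ y ∈ U, ∑ γ, ∑ δ, curvature g μ α γ δ y * (g y)⁻¹ δ γ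
      = if α = μ then -N else 0 := by
    intro μ α y hy
    refine mcancel (hgG y hy)
      (a := fun μ => ∑ γ, ∑ δ, curvature g μ α γ δ y * (g y)⁻¹ δ γ)
      (b := fun μ => if α = μ then -N else 0) ?_ μ
    intro ν
    simp only [ite_mul, zero_mul, Finset.sum_ite_eq, Finset.mem_univ, if_true]
    rw [← hEinstein y hy α ν]
    have h1 : ∀ γ, curvature g γ γ α ν y
        = ∑ δ, (∑ μ, curvature g μ γ α ν y * g y μ δ) * (g y)⁻¹ δ γ := fun γ =>
      (minv_apply (hgG y hy) (fun μ => curvature g μ γ α ν y) γ).symm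
    simp only [h1, ← Ksymm α _ _ ν y hy, Finset.sum_mul]
    rw [Finset.sum_comm]
    refine Finset.sum_congr rfl fun γ _ => ?_
    rw [Finset.sum_comm]
    exact Finset.sum_congr rfl fun i _ => Finset.sum_congr rfl fun j _ => by ring
  intro x hx
  have e5 : ∀ δ, ∑ α, dphi φ α x * wdzbar δ (gradUp g φ α) x
      = -N * (starRingEnd ℂ) (dphi φ δ x) := by
    intro δ
    have h := wdzbar_leib hU hx sp sv e0 δ
    rw [wdzbar_eq δ (fun _ => N ^ 2), wd_const] at h
    have h' : ∑ i, wdzbar δ (dphi φ i) x * gradUp g φ i x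
        = N * (starRingEnd ℂ) (dphi φ δ x) := by
      rw [← e1 δ x hx, Finset.mul_sum]
      refine Finset.sum_congr rfl fun i _ => ?_
      rw [show wdzbar δ (dphi φ i) x = N * g x i δ from hpot x hx i δ]; ring
    rw [h'] at h
    linear_combination h
  have e8 : ∑ γ, ∑ δ, (∑ α, hess20 g φ α γ x * wdzbar δ (gradUp g φ α) x) * (g x)⁻¹ δ γ
      = N ^ 2 := by
    have h1 : ∀ γ δ, ∑ α, hess20 g φ α γ x * wdzbar δ (gradUp g φ α) x
        = -N * (N * g x γ δ)
          - ∑ α, (∑ μ, curvature g μ α γ δ x * dphi φ μ x) * gradUp g φ α x := fun γ δ => by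
      rw [← e6 γ δ x hx]; ring
    have h2 : ∑ γ, ∑ δ, (-N * (N * g x γ δ)) * (g x)⁻¹ δ γ = -N ^ 2 * n := by
      have : ∀ γ, ∑ δ, g x γ δ * (g x)⁻¹ δ γ = 1 := fun γ => by
        have := congrFun (congrFun (hgG x hx) γ) γ
        rwa [Matrix.mul_apply, Matrix.one_apply_eq] at this
      have h3 : ∀ γ, ∑ δ, (-N * (N * g x γ δ)) * (g x)⁻¹ δ γ = -N ^ 2 := fun γ => by
        rw [← mul_one (-N ^ 2), ← this γ, Finset.mul_sum]
        exact Finset.sum_congr rfl fun i _ => by ring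
      simp only [h3, Finset.sum_const, Finset.card_univ, Fintype.card_fin, nsmul_eq_mul]
      ring
    have h4 : ∑ γ, ∑ δ, (∑ α, (∑ μ, curvature g μ α γ δ x * dphi φ μ x) * gradUp g φ α x)
        * (g x)⁻¹ δ γ = -N * N ^ 2 := by
      have h5 : ∀ α, ∑ μ, (∑ γ, ∑ δ, curvature g μ α γ δ x * (g x)⁻¹ δ γ) * dphi φ μ x
          = -N * dphi φ α x := fun α => by
        simp only [eRic _ α x hx, ite_mul, zero_mul, Finset.sum_ite_eq, Finset.mem_univ, if_true]
      rw [← e0 x hx, Finset.mul_sum]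
      simp only [← mul_assoc, ← h5, Finset.sum_mul]
      calc _ = ∑ γ, ∑ α, ∑ μ, ∑ δ, curvature g μ α γ δ x * dphi φ μ x * gradUp g φ α x
                * (g x)⁻¹ δ γ := by
            refine Finset.sum_congr rfl fun γ _ => ?_
            rw [Finset.sum_comm]
            refine Finset.sum_congr rfl fun α _ => ?_
            rw [Finset.sum_comm]
        _ = _ := by
            rw [Finset.sum_comm]
            refine Finset.sum_congr rfl fun α _ => ?_
            rw [Finset.sum_comm]
            refine Finset.sum_congr rfl fun μ _ => ?_
            exact Finset.sum_congr rfl fun i _ => Finset.sum_congr rfl fun j _ => by ring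
    simp only [h1, sub_mul, Finset.sum_sub_distrib]
    rw [h4, h2, hNdef]; ring
  have key := final_alg (g := g x) (G := (g x)⁻¹) (H := Matrix.of fun α γ => hess20 g φ α γ x)
    (W := Matrix.of fun α δ => wdzbar δ (gradUp g φ α) x) (p := fun α => dphi φ α x)
    (v := fun α => gradUp g φ α x) (N := N) hN hNr (hpos x hx) (hpos x hx).inv (hgG x hx)
    (funext fun γ => e1 γ x hx)
    (by
      funext γ
      have := e4 γ x hx
      simp only [Matrix.vecMul, dotProduct, Matrix.of_apply, Pi.neg_apply, Pi.smul_apply,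
        smul_eq_mul]
      rw [← neg_mul, ← this]
      exact Finset.sum_congr rfl fun i _ => mul_comm _ _)
    (by
      rw [← e8]
      simp only [Matrix.trace, Matrix.diag, Matrix.mul_apply, Matrix.transpose_apply,
        Matrix.of_apply])
    (by
      ext δ γ
      exact e7 γ δ x hx)
    (by
      funext δ
      have := e5 δ
      rw [neg_mul] at this
      exact this)
    (e0 x hx)
  intro α β
  have hk := congrFun (congrFun key α) β
  simp only [Matrix.add_apply, Matrix.smul_apply, Matrix.of_apply, Matrix.vecMulVec_apply,
    Pi.star_apply, smul_eq_mul, Matrix.zero_apply] at hk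
  have hφb : wd Complex.I β (fun y => (φ y : ℂ)) x = star (dphi φ β x) := by
    rw [← wdzbar_eq]
    have := wdzbar_conj hU hx sφ β
    simp only [Complex.conj_ofReal] at this
    exact this
  have sd : Sm U (fun y => (φ y : ℂ) / N) := by
    simp only [div_eq_mul_inv]; exact sφ.mul (Sm.const _)
  have hd : wd Complex.I β (fun y => (φ y : ℂ) / N) x = N⁻¹ * star (dphi φ β x) := by
    simp only [div_eq_mul_inv]
    rw [wd_mul hU hx sφ (Sm.const _), wd_const, hφb]; ring
  rw [wdzbar_eq, wd_mul hU hx ((Sm.const _).mul sd.cexp) (sv α), wd_mul hU hx (Sm.const _) sd.cexp,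
    wd_const, wd_cexp hU hx sd, hd, ← wdzbar_eq]
  linear_combination (Complex.I * Complex.exp ((φ x : ℂ) / N)) * hk
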